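/- Let X be at the same time a simplicial complex of rank n ≥ 1 and an n-PCM. Then for every h ∈ ΔX we have β□_{ΔX}(h) = Δ(β□_X(h)): the set of strict upper bounds of h inside the border of X equals the border of the subposet β□_X(h). -/

import Mathlib

namespace PCMPaper

variable {α : Type*} [PartialOrder α]

/-- The set of elements of `X` strictly below `h` (α□_X(h)). -/
def alphaS (X : Set α) (h : α) : Set α := {x ∈ X | x < h}

/-- The set of elements of `X` strictly above `h` (β□_X(h)). -/
def betaS (X : Set α) (h : α) : Set α := {x ∈ X | h < x}

/-- The (strict) neighborhood θ□_X(h) = α□_X(h) ∪ β□_X(h). -/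
def thetaS (X : Set α) (h : α) : Set α := alphaS X h ∪ betaS X h

/-- The rank of `h` in the poset `X`: the maximal length of a strictly increasing
chain in `X` ending at `h`.  (It equals 0 when α□_X(h) = ∅ and
`max_{x ∈ α□_X(h)} rank X x + 1` otherwise, for finite `X`.) -/
noncomputable def rank (X : Set α) (h : α) : ℕ :=
  sSup {n : ℕ | ∃ c : Fin (n + 1) → α, StrictMono c ∧ (∀ i, c i ∈ X) ∧ c (Fin.last n) = h}

open scoped Classical in
/-- The rank of the poset `X`: maximal rank of its elements, `-1` if empty. -/
noncomputable def rankSet (X : Set α) : ℤ :=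
  if X = ∅ then -1 else ((sSup (rank X '' X) : ℕ) : ℤ)

/-- One step of a path in `X`: two distinct comparable elements of `X`. -/
def rel (X : Set α) (x y : α) : Prop :=
  x ∈ X ∧ y ∈ X ∧ x ≠ y ∧ (x < y ∨ y < x)

/-- `X` is (path-)connected: any two elements are joined by a path in `X`. -/
def IsConnected (X : Set α) : Prop :=
  ∀ x ∈ X, ∀ y ∈ X, Relation.ReflTransGen (rel X) x y

/-- `IsSurfaceAux (k + 1) X` means that `X` is a (discrete) `k`-surface. -/
def IsSurfaceAux : ℕ → Set α → Prop
  | 0, X => X = ∅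
  | 1, X => ∃ x y : α, x ≠ y ∧ ¬ x < y ∧ ¬ y < x ∧ X = {x, y}
  | (n + 2), X => X.Nonempty ∧ IsConnected X ∧ ∀ h ∈ X, IsSurfaceAux (n + 1) (thetaS X h)

/-- `X` is a discrete `k`-surface (`k : ℤ`, `k ≥ -1`). -/
def IsSurface (k : ℤ) (X : Set α) : Prop :=
  ∃ n : ℕ, (n : ℤ) = k + 1 ∧ IsSurfaceAux n X

/-- The border ΔX of a poset `X` of rank `n`:
elements whose neighborhood is not an `(n-1)`-surface. -/
def border (X : Set α) : Set α :=
  {h ∈ X | ¬ IsSurface (rankSet X - 1) (thetaS X h)}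

/-- The interior of `X`. -/
def interior' (X : Set α) : Set α := X \ border X

/-- `IsPCMAux (n + 1) X` means that `X` is an `n`-PCM. -/
def IsPCMAux : ℕ → Set α → Prop
  | 0, X => X = ∅
  | 1, X => ∃ x : α, X = {x}
  | (n + 2), X => rankSet X = ((n : ℤ) + 1) ∧ IsConnected X ∧ border X ≠ ∅ ∧
      ∀ h ∈ X, (h ∈ border X → IsPCMAux (n + 1) (thetaS X h)) ∧
               (h ∉ border X → IsSurfaceAux (n + 1) (thetaS X h))

/-- `X` is an `k`-PCM (`k : ℤ`, `k ≥ -1`). -/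
def IsPCM (k : ℤ) (X : Set α) : Prop :=
  ∃ n : ℕ, (n : ℤ) = k + 1 ∧ IsPCMAux n X

/-- Fuel-indexed coherence. -/
def IsCoherentAux : ℕ → Set α → Prop
  | 0, X => X = ∅
  | (n + 1), X => X = ∅ ∨
      ∀ h ∈ X, rankSet (thetaS X h) = rankSet X - 1 ∧ IsCoherentAux n (thetaS X h)

/-- `X` is a coherent poset. -/
def IsCoherent (X : Set α) : Prop := ∃ n : ℕ, IsCoherentAux n X

/-- `X` is a separated union of `(m-1)`-surfaces: a union of `(m-1)`-surfaces such
that no element of one of them is comparable to an element of another one. -/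
def IsSeparatedUnionOfSurfacesAux (m : ℕ) (X : Set α) : Prop :=
  ∃ P : Set (Set α), P.Nonempty ∧ X = ⋃₀ P ∧ (∀ S ∈ P, IsSurfaceAux m S) ∧
    ∀ S ∈ P, ∀ T ∈ P, S ≠ T → ∀ x ∈ S, ∀ y ∈ T, ¬ x ≤ y ∧ ¬ y ≤ x

/-- `IsSmoothPCMAux (n + 1) X` means that `X` is a smooth `n`-PCM. -/
def IsSmoothPCMAux : ℕ → Set α → Prop
  | 0, X => X = ∅
  | 1, X => ∃ x : α, X = {x}
  | (n + 2), X => rankSet X = ((n : ℤ) + 1) ∧ IsConnected X ∧ border X ≠ ∅ ∧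
      IsSeparatedUnionOfSurfacesAux (n + 1) (border X) ∧
      ∀ h ∈ X, IsSurfaceAux (n + 1) (thetaS X h) ∨ IsSmoothPCMAux (n + 1) (thetaS X h)

/-- `X` is a smooth `k`-PCM (`k : ℤ`, `k ≥ -1`). -/
def IsSmoothPCM (k : ℤ) (X : Set α) : Prop :=
  ∃ n : ℕ, (n : ℤ) = k + 1 ∧ IsSmoothPCMAux n X

/-- A simplicial complex: a finite family of nonempty finite sets, closed under
taking nonempty subsets and under nonempty intersections. -/
def IsSimplicialComplex {V : Type*} [DecidableEq V] (X : Set (Finset V)) : Prop :=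
  X.Finite ∧ (∀ h ∈ X, h.Nonempty) ∧
  (∀ h ∈ X, ∀ h' : Finset V, h'.Nonempty → h' ⊆ h → h' ∈ X) ∧
  (∀ h ∈ X, ∀ h' ∈ X, (h ∩ h').Nonempty → h ∩ h' ∈ X)

/-- The dimension of a simplex. -/
def dim {V : Type*} (h : Finset V) : ℤ := (h.card : ℤ) - 1

/-- The link of a simplex `h` in a family of simplices `S`. -/
def link {V : Type*} [DecidableEq V] (h : Finset V) (S : Set (Finset V)) : Set (Finset V) :=
  {h' ∈ S | h ∩ h' = ∅ ∧ h ∪ h' ∈ S}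

/-- `X` is pure of rank `n`: every simplex is contained in an `n`-dimensional one. -/
def Pure {V : Type*} (X : Set (Finset V)) (n : ℤ) : Prop :=
  ∀ h ∈ X, ∃ g ∈ X, h ⊆ g ∧ dim g = n

/-- Any two `n`-simplices of `X` are joined by a path in `X` all of whose elements
are simplices of dimension `n - 1` or `n` (i.e. `X` is `(n-1)`-connected). -/
def NConnected {V : Type*} (X : Set (Finset V)) (n : ℤ) : Prop :=
  ∀ a ∈ X, dim a = n → ∀ b ∈ X, dim b = n →
    Relation.ReflTransGen (rel {h | h ∈ X ∧ (dim h = n - 1 ∨ dim h = n)}) a b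

/-- `X` is a pseudomanifold of rank `n`. -/
def IsPseudomanifold {V : Type*} [DecidableEq V] (X : Set (Finset V)) (n : ℤ) : Prop :=
  IsSimplicialComplex X ∧ rankSet X = n ∧
  ((n = 0 ∧ ∃ v : V, X = {({v} : Finset V)}) ∨
   (1 ≤ n ∧ Pure X n ∧
    (∀ h ∈ X, dim h = n - 1 →
      Set.ncard {g | g ∈ X ∧ h ⊆ g ∧ dim g = n} ∈ ({1, 2} : Set ℕ)) ∧
    NConnected X n))

/-- `X` is a normal pseudomanifold of rank `n`: a pseudomanifold such that the link
of every simplex of dimension at most `n - 2` is a pseudomanifold. -/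
def IsNormalPseudomanifold {V : Type*} [DecidableEq V] (X : Set (Finset V)) (n : ℤ) : Prop :=
  IsPseudomanifold X n ∧
  ∀ h ∈ X, dim h ≤ n - 2 → IsPseudomanifold (link h X) (n - dim h - 1)

theorem IsSurfaceAux.nonempty {m : ℕ} {X : Set α} (hX : IsSurfaceAux (m + 1) X) :
    X.Nonempty := by
  cases m with
  | zero =>
    obtain ⟨x, y, -, -, -, rfl⟩ := hX
    exact ⟨x, by simp⟩
  | succ m => exact hX.1

theorem IsSurfaceAux.thetaS {m : ℕ} {X : Set α} (hX : IsSurfaceAux (m + 1) X) {x : α}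
    (hx : x ∈ X) : IsSurfaceAux m (thetaS X x) := by
  cases m with
  | zero =>
    obtain ⟨a, b, -, hab, hba, rfl⟩ := hX
    change PCMPaper.thetaS _ x = ∅
    ext z
    simp only [PCMPaper.thetaS, alphaS, betaS, Set.mem_union, Set.mem_ofPred_eq,
      Set.mem_insert_iff, Set.mem_singleton_iff, Set.mem_empty_iff_false, iff_false] at hx ⊢
    rcases hx with rfl | rfl <;> rintro (⟨rfl | rfl, h⟩ | ⟨rfl | rfl, h⟩) <;>
      first | exact lt_irrefl _ h | exact hab h | exact hba h
  | succ m => exact hX.2.2 x hx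

theorem thetaS_union_left {S Y : Set α} (hlt : ∀ s ∈ S, ∀ y ∈ Y, s < y) {x : α} (hx : x ∈ S) :
    thetaS (S ∪ Y) x = thetaS S x ∪ Y := by
  ext z
  simp only [thetaS, alphaS, betaS, Set.mem_union, Set.mem_ofPred_eq]
  have h₁ := hlt x hx z
  have h₂ : z ∈ Y → ¬ z < x := fun hz h => lt_asymm h (h₁ hz)
  tauto

theorem thetaS_union_right {S Y : Set α} (hlt : ∀ s ∈ S, ∀ y ∈ Y, s < y) {x : α} (hx : x ∈ Y) :
    thetaS (S ∪ Y) x = S ∪ thetaS Y x := by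
  ext z
  simp only [thetaS, alphaS, betaS, Set.mem_union, Set.mem_ofPred_eq]
  have h₁ : z ∈ S → z < x := fun hz => hlt z hz x hx
  have h₂ : z ∈ S → ¬ x < z := fun hz h => lt_asymm h (h₁ hz)
  tauto

theorem reflTransGen_rel_of_le {X : Set α} {x y : α} (hx : x ∈ X) (hy : y ∈ X) (h : x ≤ y) :
    Relation.ReflTransGen (rel X) x y := by
  rcases h.eq_or_lt with rfl | h
  · exact .refl
  · exact .single ⟨hx, hy, h.ne, .inl h⟩

theorem reflTransGen_rel_of_ge {X : Set α} {x y : α} (hx : x ∈ X) (hy : y ∈ X) (h : y ≤ x) :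
    Relation.ReflTransGen (rel X) x y := by
  rcases h.eq_or_lt with rfl | h
  · exact .refl
  · exact .single ⟨hx, hy, h.ne', .inr h⟩

theorem isConnected_union {S Y : Set α} (hlt : ∀ s ∈ S, ∀ y ∈ Y, s < y) (hS : S.Nonempty)
    (hY : Y.Nonempty) : IsConnected (S ∪ Y) := by
  obtain ⟨s, hs⟩ := hS
  obtain ⟨t, ht⟩ := hY
  rintro x (hx | hx) y (hy | hy)
  · exact (reflTransGen_rel_of_le (.inl hx) (.inr ht) (hlt x hx t ht).le).trans
      (reflTransGen_rel_of_ge (.inr ht) (.inl hy) (hlt y hy t ht).le)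
  · exact reflTransGen_rel_of_le (.inl hx) (.inr hy) (hlt x hx y hy).le
  · exact reflTransGen_rel_of_ge (.inr hx) (.inl hy) (hlt y hy x hx).le
  · exact (reflTransGen_rel_of_ge (.inr hx) (.inl hs) (hlt s hs x hx).le).trans
      (reflTransGen_rel_of_le (.inl hs) (.inr hy) (hlt s hs y hy).le)

/-- The ordinal sum of two surfaces is a surface. -/
theorem IsSurfaceAux.union {s t : ℕ} {S Y : Set α} (hS : IsSurfaceAux s S)
    (hY : IsSurfaceAux t Y) (hlt : ∀ s ∈ S, ∀ y ∈ Y, s < y) :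
    IsSurfaceAux (s + t) (S ∪ Y) := by
  induction hk : s + t using Nat.strong_induction_on generalizing s t S Y with
  | _ k ih =>
  subst hk
  rcases s with _ | s
  · obtain rfl : S = ∅ := hS
    simpa using hY
  rcases t with _ | t
  · obtain rfl : Y = ∅ := hY
    simpa using hS
  have hst : s + 1 + (t + 1) = s + t + 2 := by omega
  rw [hst]
  refine ⟨hS.nonempty.mono Set.subset_union_left, isConnected_union hlt hS.nonempty hY.nonempty,
    ?_⟩
  rintro x (hx | hx)
  · rw [thetaS_union_left hlt hx]
    refine ih (s + t + 1) (by omega) (hS.thetaS hx) hY (fun a ha => hlt a ?_) (by omega)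
    rcases ha with ha | ha <;> exact ha.1
  · rw [thetaS_union_right hlt hx]
    refine ih (s + t + 1) (by omega) hS (hY.thetaS hx) (fun a ha y hy => hlt a ha y ?_) (by omega)
    rcases hy with hy | hy <;> exact hy.1

theorem IsSurfaceAux.of_union {s t : ℕ} {S Y : Set α} (hS : IsSurfaceAux s S)
    (hlt : ∀ s ∈ S, ∀ y ∈ Y, s < y) (hSY : IsSurfaceAux (s + t) (S ∪ Y)) :
    IsSurfaceAux t Y := by
  induction s generalizing S with
  | zero =>
    obtain rfl : S = ∅ := hS
    simpa using hSY
  | succ s ih =>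
    obtain ⟨x, hx⟩ := hS.nonempty
    refine ih (hS.thetaS hx) (fun a ha => hlt a ?_) ?_
    · rcases ha with ha | ha <;> exact ha.1
    · rw [← thetaS_union_left hlt hx]
      rw [Nat.add_right_comm] at hSY
      exact hSY.thetaS (.inl hx)

theorem isSurfaceAux_union_iff {s t : ℕ} {S Y : Set α} (hS : IsSurfaceAux s S)
    (hlt : ∀ s ∈ S, ∀ y ∈ Y, s < y) :
    IsSurfaceAux (s + t) (S ∪ Y) ↔ IsSurfaceAux t Y :=
  ⟨hS.of_union hlt, fun hY => hS.union hY hlt⟩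

theorem thetaS_Ioo {a b x : α} (hx : x ∈ Set.Ioo a b) :
    thetaS (Set.Ioo a b) x = Set.Ioo a x ∪ Set.Ioo x b := by
  ext z
  simp only [thetaS, alphaS, betaS, Set.mem_union, Set.mem_ofPred_eq, Set.mem_Ioo]
  have h₁ : z < x → z < b := fun h => h.trans hx.2
  have h₂ : x < z → a < z := fun h => hx.1.trans h
  tauto

theorem rank_eq_of_graded {Y : Set α} (f : α → ℕ)
    (hf : ∀ x ∈ Y, ∀ y ∈ Y, x < y → f x < f y)
    (hdown : ∀ x ∈ Y, ∀ j, f x = j + 1 → ∃ y ∈ Y, y < x ∧ f y = j) {x : α} (hx : x ∈ Y) :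
    rank Y x = f x := by
  refine IsGreatest.csSup_eq ⟨?_, ?_⟩
  · obtain ⟨p, hlen, hp, hlast⟩ :
        ∃ p : LTSeries α, p.length = f x ∧ (∀ i, p i ∈ Y) ∧ p.last = x := by
      induction hk : f x generalizing x with
      | zero => exact ⟨RelSeries.singleton _ x, rfl, fun _ => hx, rfl⟩
      | succ k ih =>
        obtain ⟨y, hy, hyx, hfy⟩ := hdown x hx k hk
        obtain ⟨p, hlen, hp, hlast⟩ := ih hy hfy
        have hr : p.last < x := hlast ▸ hyx
        refine ⟨p.snoc x hr, by simp [hlen], fun i => ?_, by simp⟩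
        have hi : (p.snoc x hr) i ∈ p.snoc x hr := ⟨i, rfl⟩
        rcases RelSeries.mem_snoc.1 hi with ⟨j, hj⟩ | hj
        · exact hj ▸ hp j
        · rw [hj]
          exact hx
    rw [← hlen]
    exact ⟨p, p.strictMono, hp, hlast⟩
  · rintro n ⟨c, hc, hcY, rfl⟩
    have key : ∀ i : Fin (n + 1), (i : ℕ) ≤ f (c i) := by
      intro i
      induction i using Fin.induction with
      | zero => simp
      | succ i ih =>
        have := hf _ (hcY i.castSucc) _ (hcY i.succ) (hc i.castSucc_lt_succ)
        simp only [Fin.val_castSucc, Fin.val_succ] at ih ⊢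
        omega
    simpa using key (Fin.last n)

theorem rankSet_eq_of_graded {Y : Set α} (f : α → ℕ)
    (hf : ∀ x ∈ Y, ∀ y ∈ Y, x < y → f x < f y)
    (hdown : ∀ x ∈ Y, ∀ j, f x = j + 1 → ∃ y ∈ Y, y < x ∧ f y = j) {g : α} (hg : g ∈ Y)
    (hmax : ∀ x ∈ Y, f x ≤ f g) : rankSet Y = f g := by
  rw [rankSet, if_neg (Set.nonempty_iff_ne_empty.1 ⟨g, hg⟩)]
  congr 1
  refine IsGreatest.csSup_eq ⟨⟨g, hg, rank_eq_of_graded f hf hdown hg⟩, ?_⟩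
  rintro _ ⟨x, hx, rfl⟩
  rw [rank_eq_of_graded f hf hdown hx]
  exact hmax x hx

theorem rankSet_singleton (x : α) : rankSet ({x} : Set α) = 0 :=
  rankSet_eq_of_graded (fun _ => 0) (by simp) (by simp) (Set.mem_singleton x) (by simp)

theorem IsPCMAux.rankSet_eq {m : ℕ} {X : Set α} (hX : IsPCMAux (m + 1) X) : rankSet X = m := by
  cases m with
  | zero =>
    obtain ⟨x, rfl⟩ := hX
    simpa using rankSet_singleton x
  | succ m => simpa using hX.1

theorem isSurface_iff_isSurfaceAux {k : ℤ} {m : ℕ} (hk : (m : ℤ) = k + 1) {X : Set α} :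
    IsSurface k X ↔ IsSurfaceAux m X := by
  refine ⟨?_, fun h => ⟨m, hk, h⟩⟩
  rintro ⟨m', hm', h⟩
  obtain rfl : m' = m := by omega
  exact h

section Simplicial

variable {V : Type*} [DecidableEq V]

theorem isConnected_Ioo_finset {a b : Finset V} (hab : a.card + 3 ≤ b.card) :
    IsConnected (Set.Ioo a b) := by
  have hstep : ∀ x ∈ Set.Ioo a b, ∃ u ∉ a, insert u a ⊆ x := by
    intro x hx
    obtain ⟨u, hux, hua⟩ := Finset.exists_of_ssubset hx.1
    exact ⟨u, hua, Finset.insert_subset hux hx.1.le⟩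
  intro x hx y hy
  obtain ⟨u, hua, hux⟩ := hstep x hx
  obtain ⟨v, hva, hvy⟩ := hstep y hy
  have hmem : ∀ c : Finset V, a ⊂ c → c ⊆ b → c.card < b.card → c ∈ Set.Ioo a b := by
    refine fun c hac hcb hc => ⟨hac, ?_⟩
    exact hcb.ssubset_of_ne fun h => by simp [h] at hc
  have hub : insert u a ⊆ b := hux.trans hx.2.le
  have hvb : insert v a ⊆ b := hvy.trans hy.2.le
  have hu : insert u a ∈ Set.Ioo a b := hmem _ (Finset.ssubset_insert hua) hub
    (by have := Finset.card_insert_le u a; omega)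
  have hv : insert v a ∈ Set.Ioo a b := hmem _ (Finset.ssubset_insert hva) hvb
    (by have := Finset.card_insert_le v a; omega)
  have huv : insert u (insert v a) ∈ Set.Ioo a b := hmem _
    ((Finset.ssubset_insert hva).trans_subset (Finset.subset_insert _ _))
    (Finset.insert_subset (hub (Finset.mem_insert_self _ _)) hvb)
    (by
      have := Finset.card_insert_le v a
      have := Finset.card_insert_le u (insert v a)
      omega)
  exact (((reflTransGen_rel_of_ge hx hu hux).trans (reflTransGen_rel_of_le hu huv
    (Finset.insert_subset_insert _ (Finset.subset_insert _ _)))).trans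
    (reflTransGen_rel_of_ge huv hv (Finset.subset_insert _ _))).trans
    (reflTransGen_rel_of_le hv hy hvy)

/-- The proper part of a Boolean interval of length `k + 1` is a `(k - 1)`-surface. -/
theorem isSurfaceAux_Ioo_finset {a b : Finset V} (hab : a ⊆ b) {k : ℕ}
    (hk : a.card + k + 1 = b.card) : IsSurfaceAux k (Set.Ioo a b) := by
  induction k using Nat.strong_induction_on generalizing a b with
  | _ k ih =>
  rcases k with _ | _ | k
  · refine Set.eq_empty_of_forall_notMem fun x hx => ?_
    have h₁ := Finset.card_lt_card hx.1
    have h₂ := Finset.card_lt_card hx.2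
    omega
  · have hcard : (b \ a).card = 2 := by rw [Finset.card_sdiff_of_subset hab]; omega
    obtain ⟨u, v, huv, hba⟩ := Finset.card_eq_two.1 hcard
    have hu : u ∈ b \ a := by simp [hba]
    have hv : v ∈ b \ a := by simp [hba]
    rw [Finset.mem_sdiff] at hu hv
    have hcu := Finset.card_insert_of_notMem hu.2
    have hcv := Finset.card_insert_of_notMem hv.2
    refine ⟨insert u a, insert v a, ?_, ?_, ?_, ?_⟩
    · intro h
      have : u ∈ insert v a := h ▸ Finset.mem_insert_self u a
      simp [huv, hu.2] at this
    · intro h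
      have := Finset.card_lt_card h
      omega
    · intro h
      have := Finset.card_lt_card h
      omega
    · ext x
      simp only [Set.mem_insert_iff, Set.mem_singleton_iff]
      constructor
      · rintro ⟨hax, hxb⟩
        obtain ⟨w, hwx, hwa⟩ := Finset.exists_of_ssubset hax
        have hsub : insert w a ⊆ x := Finset.insert_subset hwx hax.1
        have hcw := Finset.card_insert_of_notMem hwa
        have hcx := Finset.card_lt_card hxb
        have hx : insert w a = x := Finset.eq_of_subset_of_card_le hsub (by omega)
        have hw : w ∈ b \ a := Finset.mem_sdiff.2 ⟨hxb.1 hwx, hwa⟩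
        rw [hba, Finset.mem_insert, Finset.mem_singleton] at hw
        rcases hw with rfl | rfl
        · exact .inl hx.symm
        · exact .inr hx.symm
      · rintro (rfl | rfl)
        · refine ⟨(Finset.ssubset_insert hu.2), ?_⟩
          exact (Finset.insert_subset hu.1 hab).ssubset_of_ne fun h => by rw [h] at hcu; omega
        · refine ⟨(Finset.ssubset_insert hv.2), ?_⟩
          exact (Finset.insert_subset hv.1 hab).ssubset_of_ne fun h => by rw [h] at hcv; omega
  · refine ⟨?_, isConnected_Ioo_finset (by omega), fun x hx => ?_⟩
    · obtain ⟨c, hac, hcb, hc⟩ :=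
        Finset.exists_subsuperset_card_eq hab (n := a.card + 1) (by omega) (by omega)
      refine ⟨c, lt_of_le_of_ne hac ?_, lt_of_le_of_ne hcb ?_⟩
      · rintro rfl; omega
      · rintro rfl; omega
    · have h₁ := Finset.card_lt_card hx.1
      have h₂ := Finset.card_lt_card hx.2
      obtain ⟨i, hi⟩ := Nat.exists_eq_add_of_lt h₁
      obtain ⟨j, hj⟩ := Nat.exists_eq_add_of_lt h₂
      rw [thetaS_Ioo hx, show k + 1 = i + j by omega]
      exact (ih i (by omega) hx.1.le hi.symm).union (ih j (by omega) hx.2.le hj.symm)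
        fun s hs y hy => hs.2.trans hy.1

theorem IsSimplicialComplex.alphaS_eq {X : Set (Finset V)} (hX : IsSimplicialComplex X)
    {g : Finset V} (hg : g ∈ X) : alphaS X g = Set.Ioo ∅ g := by
  ext x
  simp only [alphaS, Set.mem_ofPred_eq, Set.mem_Ioo]
  refine ⟨fun hx => ⟨?_, hx.2⟩, fun hx => ⟨hX.2.2.1 g hg x ?_ hx.2.le, hx.2⟩⟩
  · exact Finset.empty_ssubset.2 (hX.2.1 x hx.1)
  · exact Finset.empty_ssubset.1 hx.1

theorem IsSimplicialComplex.thetaS_betaS {X : Set (Finset V)} (hX : IsSimplicialComplex X)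
    {g h : Finset V} (hg : g ∈ betaS X h) :
    thetaS (betaS X h) g = Set.Ioo h g ∪ betaS X g := by
  obtain ⟨hgX, hhg⟩ := hg
  ext x
  simp only [thetaS, alphaS, betaS, Set.mem_union, Set.mem_ofPred_eq, Set.mem_Ioo]
  have h₁ : g < x → h < x := hhg.trans
  have h₂ : h < x → x < g → x ∈ X := fun hhx hxg => hX.2.2.1 g hgX x
    (Finset.empty_ssubset.1 (lt_of_le_of_lt (Finset.empty_subset h) hhx)) hxg.le
  tauto

theorem IsSimplicialComplex.exists_card_eq {X : Set (Finset V)} (hX : IsSimplicialComplex X)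
    {h x : Finset V} (hx : x ∈ X) (hhx : h ⊆ x) {k : ℕ} (h₀ : 0 < k) (h₁ : h.card ≤ k)
    (h₂ : k < x.card) : ∃ y ∈ X, h ⊆ y ∧ y < x ∧ y.card = k := by
  obtain ⟨y, hhy, hyx, hy⟩ := Finset.exists_subsuperset_card_eq hhx h₁ h₂.le
  refine ⟨y, hX.2.2.1 x hx y (Finset.card_pos.1 (by omega)) hyx, hhy, lt_of_le_of_ne hyx ?_, hy⟩
  rintro rfl
  omega

theorem IsSimplicialComplex.rankSet_betaS {X : Set (Finset V)} (hX : IsSimplicialComplex X)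
    {g h : Finset V} (hg : g ∈ betaS X h) (hmax : ∀ x ∈ betaS X h, x.card ≤ g.card) :
    rankSet (betaS X h) = (g.card - h.card - 1 : ℕ) := by
  refine rankSet_eq_of_graded (fun x => x.card - h.card - 1) ?_ ?_ hg
    fun x hx => by have := hmax x hx; omega
  · intro x hx y hy hxy
    have h₁ := Finset.card_lt_card hx.2
    have h₂ := Finset.card_lt_card hxy
    omega
  · intro x hx j hj
    obtain ⟨y, hyX, hhy, hyx, hy⟩ := hX.exists_card_eq hx.1 hx.2.le (k := h.card + j + 1)
      (by omega) (by omega) (by omega)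
    refine ⟨y, ⟨hyX, lt_of_le_of_ne hhy ?_⟩, hyx, by omega⟩
    rintro rfl
    omega

theorem IsSimplicialComplex.rankSet_thetaS {X : Set (Finset V)} (hX : IsSimplicialComplex X)
    {g h : Finset V} (hh : h ∈ X) (hg : g ∈ betaS X h)
    (hmax : ∀ x ∈ betaS X h, x.card ≤ g.card) :
    rankSet (thetaS X h) = (g.card - 2 : ℕ) := by
  have hgh := Finset.card_lt_card hg.2
  have hpos := Finset.card_pos.2 (hX.2.1 h hh)
  have hfg : (if g.card < h.card then g.card - 1 else g.card - 2) = g.card - 2 :=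
    if_neg (by omega)
  rw [← hfg]
  refine rankSet_eq_of_graded
    (fun x : Finset V => if x.card < h.card then x.card - 1 else x.card - 2) ?_ ?_ (.inr hg) ?_
  · intro x hx y hy hxy
    have h₁ := Finset.card_lt_card hxy
    have hx₀ : 0 < x.card := Finset.card_pos.2 (hX.2.1 x (by rcases hx with hx | hx <;> exact hx.1))
    have hne : ∀ z ∈ thetaS X h, z.card ≠ h.card := by
      rintro z (hz | hz)
      · exact (Finset.card_lt_card hz.2).ne
      · exact (Finset.card_lt_card hz.2).ne'
    have hx₁ := hne x hx
    have hy₁ := hne y hy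
    split_ifs <;> omega
  · rintro x (hx | hx) j hj
    · have hxh := Finset.card_lt_card hx.2
      simp only [if_pos hxh] at hj
      obtain ⟨y, hyX, -, hyx, hy⟩ := hX.exists_card_eq hx.1 (Finset.empty_subset x) (k := j + 1)
        (by omega) (by simp) (by omega)
      refine ⟨y, .inl ⟨hyX, hyx.trans hx.2⟩, hyx, ?_⟩
      split_ifs <;> omega
    · have hxh := Finset.card_lt_card hx.2
      simp only [if_neg hxh.not_gt] at hj
      by_cases hjh : j + 1 < h.card
      · obtain ⟨y, hyX, -, hyx, hy⟩ := hX.exists_card_eq hh (Finset.empty_subset h) (k := j + 1)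
          (by omega) (by simp) (by omega)
        refine ⟨y, .inl ⟨hyX, hyx⟩, hyx.trans hx.2, ?_⟩
        split_ifs <;> omega
      · obtain ⟨y, hyX, hhy, hyx, hy⟩ := hX.exists_card_eq hx.1 hx.2.le (k := j + 2)
          (by omega) (by omega) (by omega)
        refine ⟨y, .inr ⟨hyX, lt_of_le_of_ne hhy ?_⟩, hyx, ?_⟩
        · rintro rfl
          omega
        · split_ifs <;> omega
  · rintro x (hx | hx)
    · have := Finset.card_lt_card hx.2
      split_ifs <;> omega
    · have := hmax x hx
      have := Finset.card_lt_card hx.2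
      split_ifs <;> omega

theorem IsSimplicialComplex.isSurface_thetaS_iff {X : Set (Finset V)}
    (hX : IsSimplicialComplex X) {g : Finset V} (hg : g ∈ X) {k : ℤ} {t : ℕ}
    (hk : k + 2 = g.card + t) : IsSurface k (thetaS X g) ↔ IsSurfaceAux t (betaS X g) := by
  have hpos := Finset.card_pos.2 (hX.2.1 g hg)
  rw [isSurface_iff_isSurfaceAux (m := g.card - 1 + t) (by omega), thetaS, hX.alphaS_eq hg]
  refine isSurfaceAux_union_iff (isSurfaceAux_Ioo_finset (Finset.empty_subset g) ?_)
    fun s hs y hy => hs.2.trans hy.2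
  rw [Finset.card_empty]
  omega

theorem IsSimplicialComplex.isSurface_thetaS_betaS_iff {X : Set (Finset V)}
    (hX : IsSimplicialComplex X) {g h : Finset V} (hg : g ∈ betaS X h) {k : ℤ} {t : ℕ}
    (hk : h.card + k + 2 = g.card + t) :
    IsSurface k (thetaS (betaS X h) g) ↔ IsSurfaceAux t (betaS X g) := by
  have hcard := Finset.card_lt_card hg.2
  rw [isSurface_iff_isSurfaceAux (m := g.card - h.card - 1 + t) (by omega), hX.thetaS_betaS hg]
  exact isSurfaceAux_union_iff (isSurfaceAux_Ioo_finset hg.2.le (by omega))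
    fun s hs y hy => hs.2.trans hy.2

end Simplicial

/-- If `X` is at the same time a simplicial complex of rank `n ≥ 1` and
an `n`-PCM, then for every `h ∈ ΔX`, `β□_{ΔX}(h) = Δ(β□_X(h))`. -/
theorem statement_8 {V : Type*} [DecidableEq V] (X : Set (Finset V)) (n : ℤ) (hn : 1 ≤ n)
    (hsc : IsSimplicialComplex X) (hrk : rankSet X = n) (hpcm : IsPCM n X)
    (h : Finset V) (hh : h ∈ border X) :
    betaS (border X) h = border (betaS X h) := by
  obtain ⟨N, hN, hpcm⟩ := hpcm
  obtain ⟨m, rfl⟩ : ∃ m, N = m + 2 := ⟨N - 2, by omega⟩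
  have hrθ : rankSet (thetaS X h) = m := ((hpcm.2.2.2 h hh.1).1 hh).rankSet_eq
  have key : ∀ g ∈ betaS X h, IsSurface (rankSet X - 1) (thetaS X g) ↔
      IsSurface (rankSet (betaS X h) - 1) (thetaS (betaS X h) g) := by
    intro g hg
    obtain ⟨g₀, hg₀, hmax⟩ := Set.exists_max_image (betaS X h) Finset.card
      (hsc.1.subset fun x hx => hx.1) ⟨g, hg⟩
    have hr := hsc.rankSet_thetaS hh.1 hg₀ hmax
    have hgg₀ := hmax g hg
    have hpos := Finset.card_pos.2 (hsc.2.1 h hh.1)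
    have hhg₀ := Finset.card_lt_card hg₀.2
    rw [hsc.rankSet_betaS hg₀ hmax,
      hsc.isSurface_thetaS_iff hg.1 (t := g₀.card - g.card) (by omega),
      hsc.isSurface_thetaS_betaS_iff hg (t := g₀.card - g.card) (by omega)]
  ext g
  constructor
  · rintro ⟨⟨hgX, hg⟩, hhg⟩
    exact ⟨⟨hgX, hhg⟩, fun hs => hg ((key g ⟨hgX, hhg⟩).2 hs)⟩
  · rintro ⟨hgβ, hg⟩
    exact ⟨⟨hgβ.1, fun hs => hg ((key g hgβ).1 hs)⟩, hgβ.2⟩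

end PCMPaper
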